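/- Assume δ ≠ 0. Let Γ ⊆ {1,…,c} be a set of u ≥ 1 labels and let p̲_Γ be a real number with 0 < p̲_Γ ≤ ∑_{i∈Γ} Pr(i ∈ f_{k'}(X)) and p̲_Γ/k' < 1. Then max_{i∈Γ} Pr(i ∈ f_{k'}(Y)) ≥ (k'/u) · Φ(Φ⁻¹(p̲_Γ/k') − ‖δ‖₂/σ). -/

import Mathlib

open MeasureTheory ProbabilityTheory

/-- Isotropic Gaussian measure `N(m, σ²I)` on `ℝ^d`, as a product of 1-D Gaussians. -/
noncomputable def gaussPi (d : ℕ) (m : Fin d → ℝ) (σ : ℝ) : Measure (Fin d → ℝ) :=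
  Measure.pi fun i => gaussianReal (m i) ⟨σ ^ 2, sq_nonneg σ⟩

/-- Standard Gaussian CDF `Φ`. -/
noncomputable def Phi (x : ℝ) : ℝ := (gaussianReal 0 1 (Set.Iic x)).toReal

/-- Inverse of the standard Gaussian CDF, `Φ⁻¹` (genuine inverse on `(0,1)` since `Φ` is a
strictly increasing continuous bijection from `ℝ` onto `(0,1)`). -/
noncomputable def PhiInv : ℝ → ℝ := Function.invFun Phi

/-- Euclidean dot product `aᵀb` on `ℝ^d`. -/
noncomputable def dotp (d : ℕ) (a b : Fin d → ℝ) : ℝ := ∑ i, a i * b i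

/-- Euclidean norm `‖a‖₂` on `ℝ^d`. -/
noncomputable def enorm2 (d : ℕ) (a : Fin d → ℝ) : ℝ := Real.sqrt (∑ i, a i ^ 2)

/-- One direction of the Neyman–Pearson lemma for randomized tests. -/
theorem measureReal_le_integral_of_likelihood_le {Ω : Type*} [MeasurableSpace Ω]
    {μ : Measure Ω} [IsFiniteMeasure μ] {L h : Ω → ℝ} {A : Set Ω} {t : ℝ}
    (hLm : Measurable L) (hL0 : ∀ w, 0 ≤ L w)
    [IsFiniteMeasure (μ.withDensity fun w => ENNReal.ofReal (L w))]
    (hA : MeasurableSet A) (hh : Measurable h) (hh0 : ∀ w, 0 ≤ h w) (hh1 : ∀ w, h w ≤ 1)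
    (ht : 0 ≤ t) (hin : ∀ w ∈ A, L w ≤ t) (hout : ∀ w ∉ A, t ≤ L w)
    (hle : μ.real A ≤ ∫ w, h w ∂μ) :
    (μ.withDensity fun w => ENNReal.ofReal (L w)).real A ≤
      ∫ w, h w ∂(μ.withDensity fun w => ENNReal.ofReal (L w)) := by
  have key : ∀ g : Ω → ℝ, ∫ w, g w ∂(μ.withDensity fun w => ENNReal.ofReal (L w)) =
      ∫ w, L w * g w ∂μ := by
    intro g
    rw [integral_withDensity_eq_integral_toReal_smul (by fun_prop) (by simp)]
    simp [ENNReal.toReal_ofReal (hL0 _)]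
  have hLi : Integrable L μ := by
    refine ⟨hLm.aestronglyMeasurable, ?_⟩
    rw [hasFiniteIntegral_iff_ofReal (ae_of_all _ hL0)]
    simpa [withDensity_apply] using
      measure_lt_top (μ.withDensity fun w => ENNReal.ofReal (L w)) Set.univ
  have hhi : Integrable h μ :=
    Integrable.of_bound hh.aestronglyMeasurable 1
      (ae_of_all _ fun w => by rw [Real.norm_of_nonneg (hh0 w)]; exact hh1 w)
  have h1i : Integrable (A.indicator (1 : Ω → ℝ)) μ := (integrable_const 1).indicator hA
  have hLh : Integrable (fun w => L w * h w) μ :=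
    hLi.mul_bdd (c := 1) hh.aestronglyMeasurable
      (ae_of_all _ fun w => by rw [Real.norm_of_nonneg (hh0 w)]; exact hh1 w)
  have hL1 : Integrable (fun w => L w * A.indicator (1 : Ω → ℝ) w) μ := by
    refine (hLi.indicator hA).congr (ae_of_all _ fun w => ?_)
    by_cases hw : w ∈ A <;> simp [hw]
  rw [← integral_indicator_one hA, key, key, ← sub_nonneg, ← integral_sub hLh hL1]
  rw [← integral_indicator_one hA, ← sub_nonneg, ← integral_sub hhi h1i] at hle
  refine (mul_nonneg ht hle).trans ?_
  rw [← integral_const_mul]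
  refine integral_mono ((hhi.sub h1i).const_mul t) (hLh.sub hL1) fun w => ?_
  by_cases hw : w ∈ A
  · simp only [hw, Set.indicator_of_mem, Pi.one_apply]
    nlinarith [hin w hw, hh1 w]
  · simp only [hw, not_false_eq_true, Set.indicator_of_notMem]
    nlinarith [hout w hw, hh0 w]

/-- A product of densities is a density of the product measure. -/
theorem pi_withDensity_eq_withDensity_prod {ι : Type*} [Fintype ι] {Ω : ι → Type*}
    [∀ i, MeasurableSpace (Ω i)] (μ : ∀ i, Measure (Ω i)) [∀ i, IsProbabilityMeasure (μ i)]
    {D : ∀ i, Ω i → ENNReal} (hD : ∀ i, Measurable (D i))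
    [∀ i, SigmaFinite ((μ i).withDensity (D i))] :
    Measure.pi (fun i => (μ i).withDensity (D i)) =
      (Measure.pi μ).withDensity (fun w => ∏ i, D i (w i)) := by
  refine Measure.pi_eq fun s hs => ?_
  have hm : ∀ i, Measurable ((s i).indicator (D i)) := fun i => (hD i).indicator (hs i)
  have hind : iIndepFun (fun i (w : ∀ i, Ω i) => (s i).indicator (D i) (w i)) (Measure.pi μ) :=
    iIndepFun_pi fun i => (hm i).aemeasurable
  rw [withDensity_apply _ (MeasurableSet.univ_pi hs),
    ← lintegral_indicator (MeasurableSet.univ_pi hs)]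
  calc _ = ∫⁻ w, ∏ i, (s i).indicator (D i) (w i) ∂Measure.pi μ := by
        refine lintegral_congr fun w => ?_
        by_cases hw : w ∈ Set.univ.pi s
        · rw [Set.indicator_of_mem hw]
          exact Finset.prod_congr rfl fun i _ => by
            rw [Set.indicator_of_mem (hw i (Set.mem_univ i))]
        · rw [Set.indicator_of_notMem hw]
          obtain ⟨i, hi⟩ : ∃ i, w i ∉ s i := by simpa [Set.mem_pi] using hw
          exact (Finset.prod_eq_zero (Finset.mem_univ i) (Set.indicator_of_notMem hi _)).symm
    _ = ∏ i, ∫⁻ w, (s i).indicator (D i) (w i) ∂Measure.pi μ :=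
        lintegral_prod_eq_prod_lintegral_of_indepFun Finset.univ _ hind
          (fun i => (hm i).comp (measurable_pi_apply i))
    _ = ∏ i, (μ i).withDensity (D i) (s i) := by
        refine Finset.prod_congr rfl fun i _ => ?_
        rw [withDensity_apply _ (hs i), ← lintegral_indicator (hs i),
          ← (measurePreserving_eval μ i).lintegral_comp (hm i)]

/-- A translated Gaussian is an exponential tilt of the original one. -/
theorem gaussianReal_add_eq_withDensity (m a : ℝ) {v : NNReal} (hv : v ≠ 0) :
    gaussianReal (m + a) v = (gaussianReal m v).withDensity
      (fun w => ENNReal.ofReal (Real.exp (a * (w - m) / v - a ^ 2 / (2 * v)))) := by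
  rw [gaussianReal_of_var_ne_zero _ hv, gaussianReal_of_var_ne_zero _ hv,
    ← withDensity_mul _ (measurable_gaussianPDF _ _) (by fun_prop)]
  congr 1
  ext w
  have hv' : (v : ℝ) ≠ 0 := by exact_mod_cast hv
  rw [Pi.mul_apply, gaussianPDF, gaussianPDF, ← ENNReal.ofReal_mul (gaussianPDFReal_nonneg _ _ _),
    gaussianPDFReal, gaussianPDFReal, mul_assoc (√(2 * Real.pi * v))⁻¹, ← Real.exp_add]
  congr 3
  field_simp
  ring

/-- Linear functionals of independent Gaussians are Gaussian. -/
theorem map_sum_mul_pi_gaussianReal {ι : Type*} [Fintype ι] (a m : ι → ℝ) (v : NNReal) :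
    (Measure.pi fun i => gaussianReal (m i) v).map (fun w => ∑ i, a i * w i) =
      gaussianReal (∑ i, a i * m i) (∑ i, (a i ^ 2).toNNReal * v) := by
  have hf : Measurable fun w : ι → ℝ => ∑ i, a i * w i := by fun_prop
  have := Measure.isProbabilityMeasure_map (μ := Measure.pi fun i => gaussianReal (m i) v)
    hf.aemeasurable
  refine Measure.ext_of_charFun ?_
  ext t
  rw [charFun_gaussianReal, charFun_apply_real, integral_map hf.aemeasurable (by fun_prop)]
  calc _ = ∫ w, ∏ i, Complex.exp ((t * a i : ℝ) * (w i : ℝ) * Complex.I)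
          ∂(Measure.pi fun i => gaussianReal (m i) v) := by
        congr 1
        ext w
        rw [← Complex.exp_sum]
        congr 1
        push_cast
        rw [Finset.mul_sum, Finset.sum_mul]
        exact Finset.sum_congr rfl fun i _ => by ring
    _ = ∏ i, charFun (gaussianReal (m i) v) (t * a i) := by
        simp_rw [charFun_apply_real]
        exact integral_fintype_prod_eq_prod (𝕜 := ℂ)
          (fun i (y : ℝ) => Complex.exp ((t * a i : ℝ) * (y : ℝ) * Complex.I))
    _ = _ := by
        simp_rw [charFun_gaussianReal]
        rw [← Complex.exp_sum]
        congr 1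
        push_cast
        rw [Finset.sum_sub_distrib, Finset.mul_sum, Finset.sum_mul, Finset.sum_mul,
          Finset.sum_div]
        congr 1
        · exact Finset.sum_congr rfl fun i _ => by ring
        · refine Finset.sum_congr rfl fun i _ => ?_
          rw [Real.coe_toNNReal _ (sq_nonneg _)]
          push_cast
          ring

theorem gaussianReal_real_Iic (m b : ℝ) {s : ℝ} (hs : 0 < s) {v : NNReal}
    (hv : (v : ℝ) = s ^ 2) : (gaussianReal m v).real (Set.Iic b) = Phi ((b - m) / s) := by
  have h1 : gaussianReal m v = ((gaussianReal 0 1).map (s * ·)).map (· + m) := by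
    rw [gaussianReal_map_const_mul, gaussianReal_map_add_const]
    congr 1
    · ring
    · ext; simp [hv]
  rw [h1, Measure.map_map (by fun_prop) (by fun_prop), measureReal_def,
    Measure.map_apply (by fun_prop) measurableSet_Iic, Phi]
  congr 2
  ext y
  simp [le_div_iff₀ hs, le_sub_iff_add_le, mul_comm]

theorem Phi_eq_cdf : Phi = cdf (gaussianReal 0 1) := by
  ext y
  rw [cdf_eq_real]
  rfl

theorem continuous_Phi : Continuous Phi := by
  have := nullSingletonClass_gaussianReal (μ := 0) (v := 1) one_ne_zero
  rw [Phi_eq_cdf, continuous_iff_continuousAt]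
  intro y
  have h := (cdf (gaussianReal 0 1)).measure_singleton y
  rw [measure_cdf, measure_singleton, eq_comm, ENNReal.ofReal_eq_zero, sub_nonpos] at h
  rw [(monotone_cdf _).continuousAt_iff_leftLim_eq_rightLim, StieltjesFunction.rightLim_eq]
  exact le_antisymm ((monotone_cdf _).leftLim_le le_rfl) h

theorem Phi_PhiInv {p : ℝ} (h0 : 0 < p) (h1 : p < 1) : Phi (PhiInv p) = p := by
  refine Function.invFun_eq (f := Phi) ?_
  have hbot := tendsto_cdf_atBot (gaussianReal 0 1)
  have htop := tendsto_cdf_atTop (gaussianReal 0 1)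
  rw [← Phi_eq_cdf] at hbot htop
  exact mem_range_of_exists_le_of_exists_ge continuous_Phi
    ((hbot.eventually_lt_const h0).exists.imp fun _ h => h.le)
    ((htop.eventually_const_lt h1).exists.imp fun _ h => h.le)

theorem gaussPi_eq_pi_toNNReal (d : ℕ) (m : Fin d → ℝ) (σ : ℝ) :
    gaussPi d m σ = Measure.pi fun i => gaussianReal (m i) (σ ^ 2).toNNReal := by
  have : (σ ^ 2).toNNReal = ⟨σ ^ 2, sq_nonneg σ⟩ := Real.toNNReal_of_nonneg (sq_nonneg σ)
  rw [this]
  rfl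

instance isProbabilityMeasure_gaussPi (d : ℕ) (m : Fin d → ℝ) (σ : ℝ) :
    IsProbabilityMeasure (gaussPi d m σ) := by
  rw [gaussPi_eq_pi_toNNReal]
  infer_instance

theorem sum_sq_pos_of_ne_zero {ι : Type*} [Fintype ι] {a : ι → ℝ} (ha : a ≠ 0) :
    0 < ∑ i, a i ^ 2 := by
  obtain ⟨i, hi⟩ := Function.ne_iff.mp ha
  exact Finset.sum_pos' (fun _ _ => sq_nonneg _) ⟨i, Finset.mem_univ i, sq_pos_iff.mpr hi⟩

theorem gaussPi_real_halfspace {d : ℕ} (m a : Fin d → ℝ) (ha : a ≠ 0) {σ : ℝ} (hσ : 0 < σ)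
    (b : ℝ) : (gaussPi d m σ).real {w | dotp d a w ≤ b} =
      Phi ((b - dotp d a m) / (σ * enorm2 d a)) := by
  have hpos : 0 < ∑ i, a i ^ 2 := sum_sq_pos_of_ne_zero ha
  have hm : Measurable fun w : Fin d → ℝ => ∑ i, a i * w i := by fun_prop
  rw [enorm2, ← gaussianReal_real_Iic (dotp d a m) b (mul_pos hσ (Real.sqrt_pos.mpr hpos))
    (v := ∑ i, (a i ^ 2).toNNReal * (σ ^ 2).toNNReal)]
  · rw [gaussPi_eq_pi_toNNReal, dotp, ← map_sum_mul_pi_gaussianReal, measureReal_def, measureReal_def,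
      Measure.map_apply hm measurableSet_Iic]
    rfl
  · rw [mul_pow, Real.sq_sqrt hpos.le, ← Finset.sum_mul]
    simp [Real.coe_toNNReal _ (sq_nonneg _), mul_comm]

theorem gaussPi_add_eq_withDensity {d : ℕ} (m a : Fin d → ℝ) {σ : ℝ} (hσ : 0 < σ) :
    gaussPi d (m + a) σ = (gaussPi d m σ).withDensity (fun w => ENNReal.ofReal
      (Real.exp ((dotp d a w - dotp d a m) / σ ^ 2 - (∑ i, a i ^ 2) / (2 * σ ^ 2)))) := by
  have hv0 : 0 < (σ ^ 2).toNNReal := Real.toNNReal_pos.mpr (pow_pos hσ 2)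
  have hv : ((σ ^ 2).toNNReal : ℝ) = σ ^ 2 := Real.coe_toNNReal _ (sq_nonneg σ)
  rw [gaussPi_eq_pi_toNNReal, gaussPi_eq_pi_toNNReal]
  generalize (σ ^ 2).toNNReal = v at hv0 hv
  rw [← hv]
  have hD : ∀ i, gaussianReal ((m + a) i) v = _ := fun i =>
    gaussianReal_add_eq_withDensity (m i) (a i) hv0.ne'
  have hfin : ∀ i, SigmaFinite ((gaussianReal (m i) v).withDensity
      (fun w => ENNReal.ofReal (Real.exp (a i * (w - m i) / v - a i ^ 2 / (2 * v))))) := by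
    intro i
    rw [← hD i]
    infer_instance
  simp_rw [hD]
  rw [pi_withDensity_eq_withDensity_prod _ (fun i => by fun_prop)]
  congr 1
  ext w
  rw [← ENNReal.ofReal_prod_of_nonneg (fun i _ => (Real.exp_pos _).le), ← Real.exp_sum]
  congr 2
  rw [Finset.sum_sub_distrib, ← Finset.sum_div, ← Finset.sum_div, dotp, dotp,
    ← Finset.sum_sub_distrib]
  congr 2
  exact Finset.sum_congr rfl fun i _ => by ring

/-- Gaussian Neyman–Pearson bound for a `[0, 1]`-valued test. -/
theorem Phi_sub_le_integral_gaussPi_add {d : ℕ} (x δ : Fin d → ℝ) (hδ : δ ≠ 0) {σ : ℝ}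
    (hσ : 0 < σ) {h : (Fin d → ℝ) → ℝ} (hh : Measurable h) (hh0 : ∀ w, 0 ≤ h w)
    (hh1 : ∀ w, h w ≤ 1) {p : ℝ} (hp0 : 0 < p) (hp1 : p < 1)
    (hle : p ≤ ∫ w, h w ∂(gaussPi d x σ)) :
    Phi (PhiInv p - enorm2 d δ / σ) ≤ ∫ w, h w ∂(gaussPi d (x + δ) σ) := by
  have hpos : 0 < ∑ i, δ i ^ 2 := sum_sq_pos_of_ne_zero hδ
  have hn : 0 < enorm2 d δ := Real.sqrt_pos.mpr hpos
  have hn2 : enorm2 d δ ^ 2 = ∑ i, δ i ^ 2 := Real.sq_sqrt hpos.le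
  set b := dotp d δ x + σ * enorm2 d δ * PhiInv p with hb
  have hdm : Measurable (dotp d δ) := by unfold dotp; fun_prop
  have hμ : (gaussPi d x σ).real {w | dotp d δ w ≤ b} = p := by
    rw [gaussPi_real_halfspace x δ hδ hσ, hb, add_sub_cancel_left,
      mul_div_cancel_left₀ _ (by positivity), Phi_PhiInv hp0 hp1]
  have hν : (gaussPi d (x + δ) σ).real {w | dotp d δ w ≤ b} =
      Phi (PhiInv p - enorm2 d δ / σ) := by
    rw [gaussPi_real_halfspace (x + δ) δ hδ hσ]
    congr 1
    have : dotp d δ (x + δ) = dotp d δ x + enorm2 d δ ^ 2 := by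
      rw [hn2, dotp, dotp, ← Finset.sum_add_distrib]
      exact Finset.sum_congr rfl fun i _ => by rw [Pi.add_apply]; ring
    rw [this, hb]
    field_simp
    ring
  rw [← hν]
  have hden := gaussPi_add_eq_withDensity x δ hσ
  have : IsFiniteMeasure ((gaussPi d x σ).withDensity (fun w => ENNReal.ofReal
      (Real.exp ((dotp d δ w - dotp d δ x) / σ ^ 2 - (∑ i, δ i ^ 2) / (2 * σ ^ 2))))) := by
    rw [← hden]; infer_instance
  rw [hden]
  refine measureReal_le_integral_of_likelihood_le
    (t := Real.exp ((b - dotp d δ x) / σ ^ 2 - (∑ i, δ i ^ 2) / (2 * σ ^ 2)))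
    (by fun_prop) (fun w => (Real.exp_pos _).le) (measurableSet_le hdm measurable_const)
    hh hh0 hh1 (Real.exp_pos _).le ?_ ?_ (hμ.trans_le hle)
  · intro w (hw : dotp d δ w ≤ b)
    gcongr
  · intro w hw
    have hw' : b ≤ dotp d δ w := (not_le.mp hw).le
    gcongr

/-- Joint lower bound for a set `Γ` of `u ≥ 1` labels: if `0 < p̲_Γ ≤ ∑_{i∈Γ} Pr(i ∈ f_{k'}(X))`
and `p̲_Γ/k' < 1`, then `max_{i∈Γ} Pr(i ∈ f_{k'}(Y)) ≥ (k'/u)·Φ(Φ⁻¹(p̲_Γ/k') − ‖δ‖₂/σ)`,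
where `X ~ N(x,σ²I)`, `Y ~ N(x+δ,σ²I)` and the base classifier `f` outputs exactly
`k'` labels from `{1,…,c}`. -/
theorem stmt12 {d : ℕ} (c k' : ℕ) (hk' : 1 ≤ k')
    (x δ : Fin d → ℝ) (hδ : δ ≠ 0) (σ : ℝ) (hσ : 0 < σ)
    (f : (Fin d → ℝ) → Finset (Fin c)) (hfcard : ∀ w, (f w).card = k')
    (hfm : ∀ i : Fin c, MeasurableSet {w : Fin d → ℝ | i ∈ f w})
    (Γ : Finset (Fin c)) (u : ℕ) (hu : 1 ≤ u) (hcard : Γ.card = u)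
    (pG : ℝ) (h0 : 0 < pG)
    (hle : pG ≤ ∑ i ∈ Γ, ((gaussPi d x σ) {w | i ∈ f w}).toReal)
    (hlt : pG / (k' : ℝ) < 1) :
    (k' : ℝ) / (u : ℝ) * Phi (PhiInv (pG / (k' : ℝ)) - enorm2 d δ / σ) ≤
      Γ.sup' (Finset.card_pos.mp (by omega))
        (fun i => ((gaussPi d (x + δ) σ) {w | i ∈ f w}).toReal) := by
  have hk : (0 : ℝ) < k' := by exact_mod_cast hk'
  have hu' : (0 : ℝ) < u := by exact_mod_cast hu
  have hint : ∀ m, ∫ w, (∑ i ∈ Γ, {w | i ∈ f w}.indicator (1 : (Fin d → ℝ) → ℝ) w) / k' ∂(gaussPi d m σ) =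
      (∑ i ∈ Γ, (gaussPi d m σ).real {w | i ∈ f w}) / k' := by
    intro m
    rw [integral_div, integral_finsetSum _ fun i _ => (integrable_const 1).indicator (hfm i)]
    simp_rw [integral_indicator_one (hfm _)]
  have hcount : ∀ w, ∑ i ∈ Γ, {w | i ∈ f w}.indicator (1 : (Fin d → ℝ) → ℝ) w = (Γ ∩ f w).card := by
    intro w
    simp [Set.indicator_apply]
  have hNP := Phi_sub_le_integral_gaussPi_add x δ hδ hσ
    (h := fun w => (∑ i ∈ Γ, {w | i ∈ f w}.indicator (1 : (Fin d → ℝ) → ℝ) w) / k')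
    ((Finset.measurable_sum _ fun i _ => measurable_one.indicator (hfm i)).div_const _)
    (fun w => by rw [hcount]; positivity)
    (fun w => by
      rw [hcount, div_le_one hk, ← hfcard w]
      exact_mod_cast Finset.card_le_card Finset.inter_subset_right)
    (div_pos h0 hk) hlt
    (by rw [hint]; exact div_le_div_of_nonneg_right hle hk.le)
  rw [hint, le_div_iff₀ hk] at hNP
  have hsup : ∑ i ∈ Γ, (gaussPi d (x + δ) σ).real {w | i ∈ f w} ≤
      u * Γ.sup' (Finset.card_pos.mp (by omega))
        (fun i => ((gaussPi d (x + δ) σ) {w | i ∈ f w}).toReal) := by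
    have hcard' : (Γ.card : ℝ) = u := by rw [hcard]
    rw [← hcard', ← nsmul_eq_mul]
    exact Finset.sum_le_card_nsmul _ _ _ fun i hi =>
      Finset.le_sup' (fun i => ((gaussPi d (x + δ) σ) {w | i ∈ f w}).toReal) hi
  rw [div_mul_eq_mul_div, div_le_iff₀ hu', mul_comm (k' : ℝ), mul_comm _ (u : ℝ)]
  exact hNP.trans hsup
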